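/- Define g(x) = x·(log x + log log x − 1) for real x > 1. Then for all sufficiently large n, the n-th prime-indexed prime satisfies p_{p_n} > g(g(n)), i.e. p_{p_n} > n·(log n + log log n − 1)·( log(n·(log n + log log n − 1)) + log log(n·(log n + log log n − 1)) − 1 ). -/

import Mathlib

open Filter Real

/-- `nthPrime n` is the `n`-th prime with 1-based indexing: `nthPrime 1 = 2`. -/
noncomputable def nthPrime (n : ℕ) : ℕ := Nat.nth Nat.Prime (n - 1)

/-- The lower-bound function in Dusart's bound: `g x = x·(log x + log log x − 1)`. -/
noncomputable def g (x : ℝ) : ℝ := x * (Real.log x + Real.log (Real.log x) - 1)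

lemma norm_cpow_neg_sub_cpow_neg_le {a : ℝ} (ha : 0 < a) {s : ℂ} (hs : 0 < s.re) {x : ℝ}
    (hx : x ∈ Set.Icc a (a + 1)) :
    ‖((a + 1 : ℝ) : ℂ) ^ (-s) - (x : ℂ) ^ (-s)‖ ≤ ‖s‖ * a ^ (-s.re - 1) := by
  have hd : ∀ y ∈ Set.Icc a (a + 1), HasDerivWithinAt (fun y : ℝ => (y : ℂ) ^ (-s))
      (-s * (y : ℂ) ^ (-s - 1)) (Set.Icc a (a + 1)) y := by
    intro y hy
    have hy0 : 0 < y := ha.trans_le hy.1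
    have := ((hasDerivAt_id (y : ℂ)).cpow_const (c := -s) (Or.inl hy0)).comp_ofReal
    simpa using this.hasDerivWithinAt
  have hb : ∀ y ∈ Set.Icc a (a + 1), ‖-s * (y : ℂ) ^ (-s - 1)‖ ≤ ‖s‖ * a ^ (-s.re - 1) := by
    intro y hy
    have hy0 : 0 < y := ha.trans_le hy.1
    rw [norm_mul, norm_neg, Complex.norm_cpow_eq_rpow_re_of_pos hy0]
    gcongr
    simpa using Real.rpow_le_rpow_of_nonpos ha hy.1 (by linarith : -s.re - 1 ≤ 0)
  have := (convex_Icc a (a + 1)).norm_image_sub_le_of_norm_hasDerivWithin_le hd hb hx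
    (Set.right_mem_Icc.2 (by linarith))
  refine this.trans ?_
  have h1 : ‖a + 1 - x‖ ≤ 1 := by
    rw [Real.norm_eq_abs, abs_le]; constructor <;> linarith [hx.1, hx.2]
  exact mul_le_of_le_one_right (by positivity) h1

/-- The `n`-th correction term in the Euler–Maclaurin expansion of `(s - 1) * ζ(s)`. -/
noncomputable def zetaTerm (n : ℕ) (s : ℂ) : ℂ :=
  (s - 1) * ((n : ℂ) + 1) ^ (-s) + ((n : ℂ) + 1) ^ (1 - s) - (n : ℂ) ^ (1 - s)

lemma norm_zetaTerm_le {n : ℕ} (hn : 0 < n) {s : ℂ} (hs : 0 < s.re) :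
    ‖zetaTerm n s‖ ≤ ‖s - 1‖ * ‖s‖ * (n : ℝ) ^ (-s.re - 1) := by
  have hn' : (0 : ℝ) < n := by exact_mod_cast hn
  have hd : ∀ y ∈ Set.Icc (n : ℝ) (n + 1), HasDerivWithinAt
      (fun y : ℝ => (s - 1) * ((n + 1 : ℝ) : ℂ) ^ (-s) * (y : ℂ) + (y : ℂ) ^ (1 - s))
      ((s - 1) * (((n + 1 : ℝ) : ℂ) ^ (-s) - (y : ℂ) ^ (-s))) (Set.Icc (n : ℝ) (n + 1)) y := by
    intro y hy
    have hy0 : 0 < y := hn'.trans_le hy.1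
    have h1 := ((hasDerivAt_id (y : ℂ)).cpow_const (c := 1 - s) (Or.inl hy0)).comp_ofReal
    have h2 := ((hasDerivAt_id (y : ℂ)).const_mul ((s - 1) * ((n + 1 : ℝ) : ℂ) ^ (-s))).comp_ofReal
    convert! (h2.add h1).hasDerivWithinAt using 1
    simp only [id]
    rw [show (1 : ℂ) - s - 1 = -s by ring]
    ring
  have hb : ∀ y ∈ Set.Icc (n : ℝ) (n + 1),
      ‖(s - 1) * (((n + 1 : ℝ) : ℂ) ^ (-s) - (y : ℂ) ^ (-s))‖ ≤
        ‖s - 1‖ * ‖s‖ * (n : ℝ) ^ (-s.re - 1) := by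
    intro y hy
    rw [norm_mul, mul_assoc]
    gcongr
    exact norm_cpow_neg_sub_cpow_neg_le hn' hs hy
  have := (convex_Icc (n : ℝ) (n + 1)).norm_image_sub_le_of_norm_hasDerivWithin_le hd hb
    (Set.left_mem_Icc.2 (by linarith)) (Set.right_mem_Icc.2 (by linarith))
  simp only [add_sub_cancel_left, norm_one, mul_one] at this
  refine le_trans (le_of_eq ?_) this
  congr 1
  push_cast
  rw [zetaTerm]
  ring

lemma differentiable_zetaTerm {n : ℕ} (hn : 0 < n) : Differentiable ℂ (zetaTerm n) := by
  have h1 : (n : ℂ) ≠ 0 := by exact_mod_cast hn.ne'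
  have h2 : (n : ℂ) + 1 ≠ 0 := by exact_mod_cast n.succ_ne_zero
  intro s
  unfold zetaTerm
  refine DifferentiableAt.sub (DifferentiableAt.add (DifferentiableAt.mul (by fun_prop) ?_) ?_) ?_
  · exact (differentiableAt_id.neg).const_cpow (Or.inl h2)
  · exact ((differentiableAt_const _).sub differentiableAt_id).const_cpow (Or.inl h2)
  · exact ((differentiableAt_const _).sub differentiableAt_id).const_cpow (Or.inl h1)

lemma norm_zetaTerm_le_of_norm_le {n : ℕ} (hn : 0 < n) {s : ℂ} {R : ℝ} (hs : 1 / 2 < s.re)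
    (hR : ‖s‖ < R) : ‖zetaTerm n s‖ ≤ (R + 1) * R * (n : ℝ) ^ (-(3 / 2) : ℝ) := by
  have hn' : (1 : ℝ) ≤ n := by exact_mod_cast hn
  have h0 : 0 ≤ R := (norm_nonneg s).trans hR.le
  refine (norm_zetaTerm_le hn (by linarith)).trans ?_
  have h1 : ‖s - 1‖ ≤ R + 1 := (norm_sub_le _ _).trans (by rw [norm_one]; linarith)
  gcongr
  linarith

lemma summable_shift_rpow {a : ℝ} (ha : a < -1) (N : ℕ) :
    Summable fun m : ℕ => ((N + m : ℕ) : ℝ) ^ a := by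
  have := (summable_nat_add_iff N).2 (Real.summable_nat_rpow.2 ha)
  simpa [add_comm] using this

lemma summable_zetaTerm {N : ℕ} (hN : 0 < N) {s : ℂ} (hs : 1 / 2 < s.re) :
    Summable fun m : ℕ => zetaTerm (N + m) s := by
  refine Summable.of_norm_bounded
    ((summable_shift_rpow (a := -(3 / 2)) (by norm_num) N).mul_left ((‖s‖ + 1 + 1) * (‖s‖ + 1)))
    fun m => ?_
  exact norm_zetaTerm_le_of_norm_le (by omega) hs (by linarith)

lemma sum_zetaTerm (N M : ℕ) (s : ℂ) :
    ∑ m ∈ Finset.range M, zetaTerm (N + m) s =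
      (s - 1) * (∑ n ∈ Finset.range (N + M), ((n : ℂ) + 1) ^ (-s) -
        ∑ n ∈ Finset.range N, ((n : ℂ) + 1) ^ (-s)) +
      ((N + M : ℕ) : ℂ) ^ (1 - s) - (N : ℂ) ^ (1 - s) := by
  induction M with
  | zero => simp
  | succ M ih =>
    rw [Finset.sum_range_succ, ih, ← add_assoc, Finset.sum_range_succ, zetaTerm]
    push_cast
    ring

lemma riemannZeta₁_eq_of_one_lt_re {N : ℕ} (hN : 0 < N) {s : ℂ} (hs : 1 < s.re) :
    riemannZeta₁ s = (s - 1) * ∑ n ∈ Finset.range N, ((n : ℂ) + 1) ^ (-s) +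
      (N : ℂ) ^ (1 - s) + ∑' m : ℕ, zetaTerm (N + m) s := by
  have h1 := (summable_zetaTerm hN (s := s) (by linarith)).hasSum.tendsto_sum_nat
  have hz : HasSum (fun n : ℕ => ((n : ℂ) + 1) ^ (-s)) (riemannZeta s) := by
    rw [zeta_eq_tsum_one_div_nat_add_one_cpow hs]
    have hsum : Summable fun n : ℕ => 1 / ((n : ℂ) + 1) ^ s := by
      have := (summable_nat_add_iff 1).2 (Complex.summable_one_div_nat_cpow.2 hs)
      simpa using this
    simpa [Complex.cpow_neg] using hsum.hasSum
  have h2 : Tendsto (fun M => ∑ n ∈ Finset.range (N + M), ((n : ℂ) + 1) ^ (-s)) atTop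
      (nhds (riemannZeta s)) := by
    have := (tendsto_add_atTop_iff_nat N).2 hz.tendsto_sum_nat
    simpa [add_comm] using this
  have h3 : Tendsto (fun M : ℕ => ((N + M : ℕ) : ℂ) ^ (1 - s)) atTop (nhds 0) := by
    rw [tendsto_zero_iff_norm_tendsto_zero]
    have h4 : Tendsto (fun M : ℕ => ((M : ℕ) : ℝ) ^ (-(s.re - 1))) atTop (nhds 0) :=
      (tendsto_rpow_neg_atTop (by linarith)).comp tendsto_natCast_atTop_atTop
    have h5 := (tendsto_add_atTop_iff_nat N).2 h4
    refine h5.congr fun M => ?_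
    rw [add_comm M N, Complex.norm_natCast_cpow_of_pos (by omega)]
    simp
  have h6 := (((h2.sub_const (∑ n ∈ Finset.range N, ((n : ℂ) + 1) ^ (-s))).const_mul
    (s - 1)).add h3).sub_const ((N : ℂ) ^ (1 - s))
  have h7 := tendsto_nhds_unique h1 (h6.congr fun M => (sum_zetaTerm N M s).symm)
  have hs1 : s ≠ 1 := by rintro rfl; simp at hs
  have h8 : riemannZeta₁ s = (s - 1) * riemannZeta s := by
    rw [riemannZeta_eq_inv_sub_mul hs1, mul_inv_cancel_left₀ (sub_ne_zero.2 hs1)]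
  rw [h7, h8]
  ring

lemma riemannZeta₁_eq {N : ℕ} (hN : 0 < N) {s : ℂ} (hs : 1 / 2 < s.re) :
    riemannZeta₁ s = (s - 1) * ∑ n ∈ Finset.range N, ((n : ℂ) + 1) ^ (-s) +
      (N : ℂ) ^ (1 - s) + ∑' m : ℕ, zetaTerm (N + m) s := by
  set R : ℝ := ‖s‖ + 3
  set U : Set ℂ := {z | 1 / 2 < z.re} ∩ Metric.ball 0 R
  have hUo : IsOpen U := (isOpen_lt continuous_const Complex.continuous_re).inter Metric.isOpen_ball
  have hUc : IsPreconnected U :=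
    ((convex_halfSpace_re_gt _).inter (convex_ball 0 R)).isPreconnected
  have hN0 : (N : ℂ) ≠ 0 := by exact_mod_cast hN.ne'
  have hd : DifferentiableOn ℂ (fun z => (z - 1) * ∑ n ∈ Finset.range N, ((n : ℂ) + 1) ^ (-z) +
      (N : ℂ) ^ (1 - z) + ∑' m : ℕ, zetaTerm (N + m) z) U := by
    refine DifferentiableOn.add (DifferentiableOn.add (DifferentiableOn.mul (by fun_prop) ?_) ?_) ?_
    · refine DifferentiableOn.fun_sum fun n _ => ?_
      have h2 : (n : ℂ) + 1 ≠ 0 := by exact_mod_cast n.succ_ne_zero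
      exact (differentiableOn_id.neg).const_cpow (Or.inl h2)
    · exact ((differentiableOn_const _).sub differentiableOn_id).const_cpow (Or.inl hN0)
    · refine Complex.differentiableOn_tsum_of_summable_norm
        ((summable_shift_rpow (a := -(3 / 2)) (by norm_num) N).mul_left ((R + 1) * R))
        (fun m => (differentiable_zetaTerm (by omega)).differentiableOn) hUo fun m w hw => ?_
      exact norm_zetaTerm_le_of_norm_le (by omega) hw.1 (by simpa using hw.2)
  have h2U : (2 : ℂ) ∈ U := by
    refine ⟨by norm_num, ?_⟩
    simp only [Metric.mem_ball, dist_zero_right, Complex.norm_ofNat, R]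
    linarith [norm_nonneg s]
  have heq := (differentiable_riemannZeta₁.differentiableOn.analyticOnNhd
    hUo).eqOn_of_preconnected_of_eventuallyEq (hd.analyticOnNhd hUo) hUc h2U (by
      have : {z : ℂ | 1 < z.re} ∈ nhds (2 : ℂ) :=
        (isOpen_lt continuous_const Complex.continuous_re).mem_nhds (by norm_num)
      filter_upwards [this] with z hz
      exact riemannZeta₁_eq_of_one_lt_re hN hz)
  exact heq ⟨hs, by simp [R]⟩

lemma exists_norm_riemannZeta_le : ∃ C : ℝ, 1 ≤ C ∧ ∀ s : ℂ, 99 / 100 ≤ s.re → s.re ≤ 4 →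
    2 ≤ |s.im| → ‖riemannZeta s‖ ≤ C * |s.im| ^ (1 / 50 : ℝ) := by
  set K : ℝ := ∑' n : ℕ, ((n : ℝ) + 1) ^ (-(101 / 100) : ℝ)
  have hK : Summable fun n : ℕ => ((n : ℝ) + 1) ^ (-(101 / 100) : ℝ) := by
    have := summable_shift_rpow (a := -(101 / 100)) (by norm_num) 1
    simpa [add_comm] using this
  have hK0 : 0 ≤ K := tsum_nonneg fun n => by positivity
  refine ⟨2 * K + 2 + 3 * K, by linarith, fun s hs hs4 ht => ?_⟩
  set T := |s.im| with hT
  have hT0 : 0 < T := by linarith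
  obtain ⟨N, hN⟩ : ∃ N : ℕ, N = ⌈T⌉₊ := ⟨_, rfl⟩
  have hNT : T ≤ N := by rw [hN]; exact Nat.le_ceil T
  have hNT2 : (N : ℝ) ≤ 2 * T := by
    rw [hN]; have := Nat.ceil_lt_add_one hT0.le; linarith
  have hN0 : 0 < N := by
    have : (0 : ℝ) < N := by linarith
    exact_mod_cast this
  have hNr : (0 : ℝ) < N := by exact_mod_cast hN0
  have hN1 : (1 : ℝ) ≤ N := by exact_mod_cast hN0
  have hNpow : (N : ℝ) ^ (1 / 50 : ℝ) ≤ 2 * T ^ (1 / 50 : ℝ) := by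
    calc (N : ℝ) ^ (1 / 50 : ℝ) ≤ (2 * T) ^ (1 / 50 : ℝ) := by gcongr
      _ = 2 ^ (1 / 50 : ℝ) * T ^ (1 / 50 : ℝ) := Real.mul_rpow (by norm_num) hT0.le
      _ ≤ 2 * T ^ (1 / 50 : ℝ) := by
        gcongr
        calc (2 : ℝ) ^ (1 / 50 : ℝ) ≤ 2 ^ (1 : ℝ) :=
              Real.rpow_le_rpow_of_exponent_le (by norm_num) (by norm_num)
          _ = 2 := Real.rpow_one 2
  have hTp : 0 < T ^ (1 / 50 : ℝ) := by positivity
  have hs1 : s ≠ 1 := by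
    rintro rfl
    simp [hT] at ht
    linarith
  have hsT : T ≤ ‖s - 1‖ := by
    have := Complex.abs_im_le_norm (s - 1)
    simpa using this
  have hsn : ‖s‖ ≤ 3 * T := by
    have := Complex.norm_le_abs_re_add_abs_im s
    rw [abs_of_nonneg (by linarith : 0 ≤ s.re)] at this
    linarith
  have hsum : ‖∑ n ∈ Finset.range N, ((n : ℂ) + 1) ^ (-s)‖ ≤ K * (N : ℝ) ^ (1 / 50 : ℝ) := by
    calc ‖∑ n ∈ Finset.range N, ((n : ℂ) + 1) ^ (-s)‖
        ≤ ∑ n ∈ Finset.range N, ((n : ℝ) + 1) ^ (-(101 / 100) : ℝ) * (N : ℝ) ^ (1 / 50 : ℝ) := by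
          refine norm_sum_le_of_le _ fun n hn => ?_
          have h1 : ((n : ℂ) + 1) = ((n + 1 : ℕ) : ℂ) := by push_cast; rfl
          rw [h1, Complex.norm_natCast_cpow_of_pos (by omega), Complex.neg_re]
          push_cast
          have hn1 : (n : ℝ) + 1 ≤ N := by exact_mod_cast Finset.mem_range.1 hn
          calc ((n : ℝ) + 1) ^ (-s.re) ≤ ((n : ℝ) + 1) ^ (-(101 / 100) + 1 / 50 : ℝ) :=
                Real.rpow_le_rpow_of_exponent_le (by linarith [n.cast_nonneg (α := ℝ)])
                  (by linarith)
            _ = ((n : ℝ) + 1) ^ (-(101 / 100) : ℝ) * ((n : ℝ) + 1) ^ (1 / 50 : ℝ) :=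
                Real.rpow_add (by positivity) _ _
            _ ≤ _ := by gcongr
      _ = (∑ n ∈ Finset.range N, ((n : ℝ) + 1) ^ (-(101 / 100) : ℝ)) * (N : ℝ) ^ (1 / 50 : ℝ) := by
          rw [Finset.sum_mul]
      _ ≤ K * (N : ℝ) ^ (1 / 50 : ℝ) := by
          gcongr
          exact hK.sum_le_tsum _ fun n _ => by positivity
  have hmid : ‖(N : ℂ) ^ (1 - s)‖ ≤ (N : ℝ) ^ (1 / 50 : ℝ) := by
    rw [Complex.norm_natCast_cpow_of_pos hN0]
    refine Real.rpow_le_rpow_of_exponent_le hN1 ?_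
    simp only [Complex.sub_re, Complex.one_re]
    linarith
  have htail : ‖∑' m : ℕ, zetaTerm (N + m) s‖ ≤
      ‖s - 1‖ * (3 * K * T ^ (1 / 50 : ℝ)) := by
    have hterm : ∀ m : ℕ, ‖zetaTerm (N + m) s‖ ≤
        ‖s - 1‖ * (3 * T ^ (1 / 50 : ℝ)) * ((m : ℝ) + 1) ^ (-(101 / 100) : ℝ) := by
      intro m
      refine (norm_zetaTerm_le (by omega) (by linarith)).trans ?_
      have h1 : (((N + m : ℕ) : ℝ)) ^ (-s.re - 1) ≤
          T ^ (-1 + 1 / 50 : ℝ) * ((m : ℝ) + 1) ^ (-(101 / 100) : ℝ) := by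
        have hT1 : T ≤ ((N + m : ℕ) : ℝ) := by push_cast; linarith [m.cast_nonneg (α := ℝ)]
        have hm1 : (m : ℝ) + 1 ≤ ((N + m : ℕ) : ℝ) := by push_cast; linarith
        calc (((N + m : ℕ) : ℝ)) ^ (-s.re - 1)
            ≤ (((N + m : ℕ) : ℝ)) ^ ((-1 + 1 / 50) + -(101 / 100) : ℝ) :=
              Real.rpow_le_rpow_of_exponent_le (by linarith) (by linarith)
          _ = (((N + m : ℕ) : ℝ)) ^ (-1 + 1 / 50 : ℝ) *
              (((N + m : ℕ) : ℝ)) ^ (-(101 / 100) : ℝ) := Real.rpow_add (by linarith) _ _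
          _ ≤ _ := by
            gcongr ?_ * ?_
            · exact Real.rpow_le_rpow_of_nonpos hT0 hT1 (by norm_num)
            · exact Real.rpow_le_rpow_of_nonpos (by positivity) hm1 (by norm_num)
      have h2 : T ^ (-1 + 1 / 50 : ℝ) = T⁻¹ * T ^ (1 / 50 : ℝ) := by
        rw [Real.rpow_add hT0, Real.rpow_neg_one]
      calc ‖s - 1‖ * ‖s‖ * (((N + m : ℕ) : ℝ)) ^ (-s.re - 1)
          ≤ ‖s - 1‖ * (3 * T) * (T ^ (-1 + 1 / 50 : ℝ) * ((m : ℝ) + 1) ^ (-(101 / 100) : ℝ)) := by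
            gcongr
        _ = _ := by rw [h2]; field_simp
    refine (tsum_of_norm_bounded (hK.mul_left _).hasSum hterm).trans (le_of_eq ?_)
    rw [tsum_mul_left]
    ring
  have hpos : 0 < ‖s - 1‖ := by linarith
  rw [riemannZeta_eq_inv_sub_mul hs1, norm_mul, norm_inv, inv_mul_le_iff₀ hpos,
    riemannZeta₁_eq hN0 (by linarith : (1 : ℝ) / 2 < s.re)]
  refine (norm_add₃_le).trans ?_
  rw [norm_mul]
  have hmid2 : (N : ℝ) ^ (1 / 50 : ℝ) ≤ ‖s - 1‖ * (2 * T ^ (1 / 50 : ℝ)) := by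
    nlinarith
  calc ‖s - 1‖ * ‖∑ n ∈ Finset.range N, ((n : ℂ) + 1) ^ (-s)‖ + ‖(N : ℂ) ^ (1 - s)‖ +
        ‖∑' m : ℕ, zetaTerm (N + m) s‖
      ≤ ‖s - 1‖ * (K * (2 * T ^ (1 / 50 : ℝ))) + ‖s - 1‖ * (2 * T ^ (1 / 50 : ℝ)) +
        ‖s - 1‖ * (3 * K * T ^ (1 / 50 : ℝ)) := by
        gcongr
        · exact hsum.trans (by gcongr)
        · exact hmid.trans hmid2
    _ = _ := by ring

lemma rpow_le_two_mul_rpow {x y : ℝ} (hx : 0 ≤ x) (hy : 0 ≤ y) (h : x ≤ 2 * y) :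
    x ^ (1 / 50 : ℝ) ≤ 2 * y ^ (1 / 50 : ℝ) := by
  calc x ^ (1 / 50 : ℝ) ≤ (2 * y) ^ (1 / 50 : ℝ) := by gcongr
    _ = 2 ^ (1 / 50 : ℝ) * y ^ (1 / 50 : ℝ) := Real.mul_rpow (by norm_num) hy
    _ ≤ 2 * y ^ (1 / 50 : ℝ) := by
      gcongr
      calc (2 : ℝ) ^ (1 / 50 : ℝ) ≤ 2 ^ (1 : ℝ) :=
            Real.rpow_le_rpow_of_exponent_le (by norm_num) (by norm_num)
        _ = 2 := Real.rpow_one 2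

lemma abs_re_sub_le {z s : ℂ} {r : ℝ} (h : ‖z - s‖ ≤ r) : |z.re - s.re| ≤ r := by
  have := Complex.abs_re_le_norm (z - s)
  rw [Complex.sub_re] at this
  exact this.trans h

lemma abs_im_sub_le {z s : ℂ} {r : ℝ} (h : ‖z - s‖ ≤ r) : |z.im - s.im| ≤ r := by
  have := Complex.abs_im_le_norm (z - s)
  rw [Complex.sub_im] at this
  exact this.trans h

lemma abs_im_mem_of_norm_sub_le {z s : ℂ} {r : ℝ} (h : ‖z - s‖ ≤ r) :
    |s.im| - r ≤ |z.im| ∧ |z.im| ≤ |s.im| + r := by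
  have h1 := abs_im_sub_le h
  have h2 := abs_sub_abs_le_abs_sub z.im s.im
  have h3 := abs_sub_abs_le_abs_sub s.im z.im
  rw [abs_sub_comm] at h3
  constructor <;> linarith

lemma exists_norm_deriv_riemannZeta_le : ∃ C : ℝ, 1 ≤ C ∧ ∀ s : ℂ, 199 / 200 ≤ s.re →
    s.re ≤ 3 → 3 ≤ |s.im| → ‖deriv riemannZeta s‖ ≤ C * |s.im| ^ (1 / 50 : ℝ) := by
  obtain ⟨C, hC1, hC⟩ := exists_norm_riemannZeta_le
  refine ⟨400 * C, by linarith, fun s hs hs3 ht => ?_⟩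
  have hd : DifferentiableOn ℂ riemannZeta (Metric.closedBall s (1 / 200)) := by
    intro z hz
    rw [Metric.mem_closedBall, dist_eq_norm] at hz
    refine (differentiableAt_riemannZeta ?_).differentiableWithinAt
    rintro rfl
    have := abs_im_mem_of_norm_sub_le hz
    simp at this
    linarith
  have := Complex.norm_deriv_le_of_forall_mem_sphere_norm_le (c := s) (R := 1 / 200)
    (C := C * (2 * |s.im| ^ (1 / 50 : ℝ))) (f := riemannZeta) (by norm_num)
    (DifferentiableOn.diffContOnCl_ball hd subset_rfl) (fun z hz => by
      rw [mem_sphere_iff_norm] at hz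
      have h1 := abs_im_mem_of_norm_sub_le hz.le
      have h2 := abs_le.1 (abs_re_sub_le hz.le)
      refine (hC z (by linarith) (by linarith) (by linarith)).trans ?_
      gcongr
      exact rpow_le_two_mul_rpow (abs_nonneg _) (abs_nonneg _) (by linarith))
  refine this.trans (le_of_eq ?_)
  ring

lemma one_le_norm_riemannZeta_product {x : ℝ} (hx : 0 < x) (y : ℝ) :
    1 ≤ ‖riemannZeta (1 + x)‖ ^ 3 * ‖riemannZeta (1 + x + Complex.I * y)‖ ^ 4 *
      ‖riemannZeta (1 + x + 2 * Complex.I * y)‖ := by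
  have := DirichletCharacter.norm_LFunction_product_ge_one (1 : DirichletCharacter ℂ 1) hx y
  simpa [DirichletCharacter.LFunctionTrivChar, DirichletCharacter.LFunction_modOne_eq] using this

lemma exists_norm_riemannZeta_one_add_le : ∃ K : ℝ, 1 ≤ K ∧ ∀ x : ℝ, 0 < x → x ≤ 1 →
    ‖riemannZeta (1 + x)‖ ≤ K / x := by
  have hc : ContinuousOn (fun x : ℝ => riemannZeta₀ (1 + x)) (Set.Icc 0 1) :=
    (differentiable_riemannZeta₀.continuous.comp (by fun_prop)).continuousOn
  obtain ⟨M, hM⟩ := isCompact_Icc.exists_bound_of_continuousOn hc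
  have hM0 : 0 ≤ M := (norm_nonneg _).trans (hM 0 (by simp))
  refine ⟨1 + M, by linarith, fun x hx hx1 => ?_⟩
  have hne : (1 + x : ℂ) ≠ 1 := by
    simpa using hx.ne'
  rw [riemannZeta_eq_inv_sub_add hne, add_div]
  refine (norm_add_le _ _).trans (add_le_add (le_of_eq ?_) ?_)
  · simp [abs_of_pos hx]
  · refine (hM x ⟨hx.le, hx1⟩).trans ?_
    rw [le_div_iff₀ hx]
    nlinarith

lemma exists_le_norm_riemannZeta : ∃ c : ℝ, 0 < c ∧ ∀ s : ℂ, 1 < s.re → s.re ≤ 2 →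
    3 ≤ |s.im| → c / (|s.im| ^ (1 / 50 : ℝ)) ^ 4 ≤ ‖riemannZeta s‖ := by
  obtain ⟨C, hC1, hC⟩ := exists_norm_riemannZeta_le
  obtain ⟨D, hD1, hD⟩ := exists_norm_deriv_riemannZeta_le
  obtain ⟨K, hK1, hK⟩ := exists_norm_riemannZeta_one_add_le
  set c₀ : ℝ := 1 / (2 * K ^ 3 * C) with hc₀
  have hc₀0 : 0 < c₀ := by positivity
  have hc₀1 : c₀ ≤ 1 := by
    rw [hc₀, div_le_one (by positivity)]
    have : 1 ≤ K ^ 3 := one_le_pow₀ hK1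
    nlinarith
  set c₁ : ℝ := c₀ / (16 * D ^ 4) with hc₁
  have hc₁0 : 0 < c₁ := by positivity
  have hc₁1 : c₁ ≤ 1 := by
    rw [hc₁, div_le_one (by positivity)]
    have : 1 ≤ D ^ 4 := one_le_pow₀ hD1
    linarith
  refine ⟨D * c₁, by positivity, fun s hs hs2 ht => ?_⟩
  set u := |s.im| ^ (1 / 50 : ℝ) with hu
  have hu1 : 1 ≤ u := Real.one_le_rpow (by linarith) (by norm_num)
  have hu0 : 0 < u := by linarith
  have key : ∀ y : ℝ, 0 < y → y ≤ 1 →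
      c₀ * y ^ 3 / u ≤ ‖riemannZeta (1 + y + Complex.I * s.im)‖ ^ 4 := by
    intro y hy hy1
    have h1 := one_le_norm_riemannZeta_product hy s.im
    have h2 := hK y hy hy1
    have h3 : ‖riemannZeta (1 + y + 2 * Complex.I * s.im)‖ ≤ C * (2 * u) := by
      have him : (1 + y + 2 * Complex.I * s.im : ℂ).im = 2 * s.im := by simp
      have hre : (1 + y + 2 * Complex.I * s.im : ℂ).re = 1 + y := by simp
      have habs : |2 * s.im| = 2 * |s.im| := by rw [abs_mul, abs_two]
      refine (hC _ (by rw [hre]; linarith) (by rw [hre]; linarith)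
        (by rw [him, habs]; linarith)).trans ?_
      rw [him, habs]
      gcongr
      exact rpow_le_two_mul_rpow (by positivity) (abs_nonneg _) le_rfl
    set Z := ‖riemannZeta (1 + y + Complex.I * s.im)‖ ^ 4
    have hZ : 0 ≤ Z := by positivity
    have h4 : 1 ≤ (K / y) ^ 3 * Z * (C * (2 * u)) := by
      refine h1.trans ?_
      gcongr
    have h5 : (K / y) ^ 3 * Z * (C * (2 * u)) = Z / (c₀ * y ^ 3 / u) := by
      rw [hc₀]; field_simp
    rw [h5, one_le_div (by positivity)] at h4
    exact h4
  set x := c₁ / u ^ 5 with hx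
  have hx0 : 0 < x := by positivity
  have hx1 : x ≤ 1 := by
    rw [hx, div_le_one (by positivity)]
    exact hc₁1.trans (one_le_pow₀ hu1)
  have hlow : ∀ y : ℝ, x ≤ y → y ≤ 1 →
      2 * D * u * x ≤ ‖riemannZeta (1 + y + Complex.I * s.im)‖ := by
    intro y hxy hy1
    refine le_of_pow_le_pow_left₀ (n := 4) (by norm_num) (norm_nonneg _) ?_
    refine le_trans ?_ (key y (by linarith) hy1)
    calc (2 * D * u * x) ^ 4 = c₀ * x ^ 3 / u := by
          rw [mul_pow _ x, pow_succ x 3]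
          nth_rw 2 [hx]
          rw [hc₁]
          field_simp
          ring
      _ ≤ c₀ * y ^ 3 / u := by gcongr
  have hval : D * c₁ / u ^ 4 = D * u * x := by
    rw [hx]; field_simp
  rw [hval]
  have hsrep : ∀ σ : ℝ, (σ + s.im * Complex.I : ℂ) = 1 + (σ - 1 : ℝ) + Complex.I * s.im := by
    intro σ; push_cast; ring
  have hs_eq : s = 1 + (s.re - 1 : ℝ) + Complex.I * s.im := by
    rw [← hsrep, Complex.re_add_im]
  have hDux : 0 ≤ D * u * x := by positivity
  rcases le_total x (s.re - 1) with h | h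
  · have := hlow (s.re - 1) h (by linarith)
    rw [← hs_eq] at this
    linarith
  · have h1 := hlow x le_rfl hx1
    set w : ℂ := 1 + x + Complex.I * s.im with hw
    have hwre : w.re = 1 + x := by simp [hw]
    have hwim : w.im = s.im := by simp [hw]
    have hconv : Convex ℝ {z : ℂ | 1 ≤ z.re ∧ z.re ≤ 3 ∧ z.im = s.im} := by
      have h1 := (convex_halfSpace_re_ge 1).inter
        ((convex_halfSpace_re_le 3).inter (convex_hyperplane Complex.imLm.isLinear s.im))
      convert! h1 using 1
    have h2 := hconv.norm_image_sub_le_of_norm_deriv_le (f := riemannZeta) (C := D * u)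
      (fun z hz => differentiableAt_riemannZeta (by
        rintro rfl
        have := hz.2.2
        rw [Complex.one_im] at this
        rw [← this] at ht
        simp at ht
        linarith))
      (fun z hz => by
        have := hD z (by linarith [hz.1]) hz.2.1 (by rw [hz.2.2]; exact ht)
        rwa [hz.2.2] at this)
      (show s ∈ _ from ⟨hs.le, by linarith, rfl⟩)
      (show w ∈ _ from ⟨by rw [hwre]; linarith, by rw [hwre]; linarith, hwim⟩)
    have h3 : ‖w - s‖ ≤ x := by
      have : w - s = ((x - (s.re - 1) : ℝ) : ℂ) := by
        rw [hs_eq, hw]; push_cast; simp; ring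
      rw [this, Complex.norm_real, Real.norm_eq_abs, abs_of_nonneg (by linarith)]
      linarith
    have h4 : ‖riemannZeta w‖ - ‖riemannZeta s‖ ≤ D * u * x :=
      (norm_sub_norm_le _ _).trans (h2.trans (by gcongr))
    linarith

/-- The function `-ζ'/ζ - ζ`, holomorphically extended to `s = 1`. -/
noncomputable def zetaDiff (s : ℂ) : ℂ :=
  -(deriv riemannZeta₁ s / riemannZeta₁ s) - riemannZeta₀ s

lemma riemannZeta₁_ne_zero {s : ℂ} (hs : s ≠ 1) (h : riemannZeta s ≠ 0) :
    riemannZeta₁ s ≠ 0 := by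
  rw [riemannZeta_eq_inv_sub_mul hs] at h
  exact right_ne_zero_of_mul h

lemma zetaDiff_eq {s : ℂ} (hs : s ≠ 1) (h : riemannZeta s ≠ 0) :
    zetaDiff s = -deriv riemannZeta s / riemannZeta s - riemannZeta s := by
  have h1 := riemannZeta₁_ne_zero hs h
  have h2 := sub_ne_zero.2 hs
  have h3 : -deriv riemannZeta s / riemannZeta s =
      -(deriv riemannZeta₁ s / riemannZeta₁ s) + (s - 1)⁻¹ := by
    rw [deriv_riemannZeta_eq_neg_inv_sub_sq_mul_add hs, riemannZeta_eq_inv_sub_mul hs]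
    field_simp
    ring
  rw [zetaDiff, h3, riemannZeta_eq_inv_sub_add hs]
  ring

lemma differentiableAt_zetaDiff {s : ℂ} (h : riemannZeta₁ s ≠ 0) :
    DifferentiableAt ℂ zetaDiff s := by
  unfold zetaDiff
  exact ((differentiable_riemannZeta₁.deriv s).div (differentiable_riemannZeta₁ s) h).neg.sub
    (differentiable_riemannZeta₀ s)

lemma exists_norm_iteratedDeriv_zetaDiff_le_of_le_abs_im : ∃ C : ℝ, 0 ≤ C ∧ ∀ s : ℂ, 1 < s.re →
    s.re ≤ 2 → 4 ≤ |s.im| → ‖iteratedDeriv 4 zetaDiff s‖ ≤ C * |s.im| ^ (1 / 2 : ℝ) := by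
  obtain ⟨C, hC1, hC⟩ := exists_norm_riemannZeta_le
  obtain ⟨D, hD1, hD⟩ := exists_norm_deriv_riemannZeta_le
  obtain ⟨c, hc0, hc⟩ := exists_le_norm_riemannZeta
  set k : ℝ := min (1 / 200) (c / (4 * D)) with hk
  have hk0 : 0 < k := by positivity
  have hkD : 2 * D * k ≤ c / 2 := by
    have : k ≤ c / (4 * D) := min_le_right _ _
    rw [le_div_iff₀ (by positivity)] at this
    linarith
  refine ⟨24 * (4 * D / c + 2 * C) / k ^ 4, by positivity, fun s hs hs2 ht => ?_⟩
  set u := |s.im| ^ (1 / 50 : ℝ) with hu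
  have hu1 : 1 ≤ u := Real.one_le_rpow (by linarith) (by norm_num)
  have hu0 : 0 < u := by linarith
  set r : ℝ := k / u ^ 5 with hr
  have hr0 : 0 < r := by positivity
  have hr1 : r ≤ 1 / 200 := by
    refine le_trans ?_ (min_le_left (1 / 200) (c / (4 * D)))
    exact div_le_self hk0.le (one_le_pow₀ hu1)
  have him : ∀ z ∈ Metric.closedBall s r, |s.im| - 1 ≤ |z.im| ∧ |z.im| ≤ 2 * |s.im| := by
    intro z hz
    rw [Metric.mem_closedBall, dist_eq_norm] at hz
    have h1 := abs_im_mem_of_norm_sub_le hz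
    constructor <;> linarith
  have hre : ∀ z ∈ Metric.closedBall s r, 199 / 200 ≤ z.re ∧ z.re ≤ 3 := by
    intro z hz
    rw [Metric.mem_closedBall, dist_eq_norm] at hz
    have h1 := abs_le.1 (abs_re_sub_le hz)
    constructor <;> linarith
  have hpow : ∀ z ∈ Metric.closedBall s r, |z.im| ^ (1 / 50 : ℝ) ≤ 2 * u := fun z hz =>
    rpow_le_two_mul_rpow (abs_nonneg _) (abs_nonneg _) (him z hz).2
  have hne1 : ∀ z ∈ Metric.closedBall s r, z ≠ 1 := by
    rintro z hz rfl
    have := (him _ hz).1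
    simp at this
    linarith
  have hD' : ∀ z ∈ Metric.closedBall s r, ‖deriv riemannZeta z‖ ≤ 2 * D * u := by
    intro z hz
    refine (hD z (hre z hz).1 (hre z hz).2 (by linarith [(him z hz).1])).trans ?_
    nlinarith [hpow z hz]
  have hC' : ∀ z ∈ Metric.closedBall s r, ‖riemannZeta z‖ ≤ 2 * C * u := by
    intro z hz
    refine (hC z (by linarith [(hre z hz).1]) (by linarith [(hre z hz).2])
      (by linarith [(him z hz).1])).trans ?_
    nlinarith [hpow z hz]
  have hlow : ∀ z ∈ Metric.closedBall s r, c / 2 / u ^ 4 ≤ ‖riemannZeta z‖ := by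
    intro z hz
    have h1 := (convex_closedBall s r).norm_image_sub_le_of_norm_deriv_le (f := riemannZeta)
      (fun z hz => differentiableAt_riemannZeta (hne1 z hz)) hD' hz
      (Metric.mem_closedBall_self hr0.le)
    have h2 : ‖s - z‖ ≤ r := by
      rw [Metric.mem_closedBall, dist_comm, dist_eq_norm] at hz
      exact hz
    have h3 : ‖riemannZeta s‖ - ‖riemannZeta z‖ ≤ 2 * D * u * r :=
      (norm_sub_norm_le _ _).trans (h1.trans (by gcongr))
    have h4 := hc s hs hs2 (by linarith)
    have h5 : 2 * D * u * r ≤ c / 2 / u ^ 4 := by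
      have : 2 * D * u * r = 2 * D * k / u ^ 4 := by rw [hr]; field_simp
      rw [this]
      gcongr
    have h6 : c / u ^ 4 = c / 2 / u ^ 4 + c / 2 / u ^ 4 := by ring
    linarith
  have hne0 : ∀ z ∈ Metric.closedBall s r, riemannZeta z ≠ 0 := fun z hz =>
    norm_pos_iff.1 (lt_of_lt_of_le (by positivity) (hlow z hz))
  have hbound : ∀ z ∈ Metric.sphere s r, ‖zetaDiff z‖ ≤ (4 * D / c + 2 * C) * u ^ 5 := by
    intro z hz
    replace hz := Metric.sphere_subset_closedBall hz
    rw [zetaDiff_eq (hne1 z hz) (hne0 z hz), add_mul]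
    refine (norm_sub_le _ _).trans (add_le_add ?_ ?_)
    · rw [norm_div, norm_neg]
      calc ‖deriv riemannZeta z‖ / ‖riemannZeta z‖ ≤ 2 * D * u / (c / 2 / u ^ 4) := by
            gcongr
            · exact hD' z hz
            · exact hlow z hz
        _ = 4 * D / c * u ^ 5 := by field_simp; norm_num
    · refine (hC' z hz).trans ?_
      have : u ≤ u ^ 5 := le_self_pow₀ hu1 (by norm_num)
      gcongr
  have hdiff : DifferentiableOn ℂ zetaDiff (Metric.closedBall s r) := fun z hz =>
    (differentiableAt_zetaDiff
      (riemannZeta₁_ne_zero (hne1 z hz) (hne0 z hz))).differentiableWithinAt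
  refine (Complex.norm_iteratedDeriv_le_of_forall_mem_sphere_norm_le 4 hr0
    (DifferentiableOn.diffContOnCl_ball hdiff subset_rfl) hbound).trans (le_of_eq ?_)
  have hu25 : |s.im| ^ (1 / 2 : ℝ) = u ^ 25 := by
    rw [hu, ← Real.rpow_natCast, ← Real.rpow_mul (abs_nonneg _)]
    norm_num
  rw [hu25, hr, show Nat.factorial 4 = 24 from rfl]
  push_cast
  field_simp

lemma exists_norm_iteratedDeriv_zetaDiff_le : ∃ C : ℝ, 0 ≤ C ∧ ∀ s : ℂ, 1 < s.re →
    s.re ≤ 2 → ‖iteratedDeriv 4 zetaDiff s‖ ≤ C * (1 + s.im ^ 2) ^ (1 / 4 : ℝ) := by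
  obtain ⟨C, hC0, hC⟩ := exists_norm_iteratedDeriv_zetaDiff_le_of_le_abs_im
  have hopen : IsOpen {s : ℂ | riemannZeta₁ s ≠ 0} :=
    isOpen_ne_fun differentiable_riemannZeta₁.continuous continuous_const
  have hdiff : DifferentiableOn ℂ zetaDiff {s : ℂ | riemannZeta₁ s ≠ 0} := fun z hz =>
    (differentiableAt_zetaDiff hz).differentiableWithinAt
  have hcont : ContinuousOn (iteratedDeriv 4 zetaDiff) {s : ℂ | riemannZeta₁ s ≠ 0} := by
    rw [iteratedDeriv_eq_iterate]
    exact ((hdiff.analyticOnNhd hopen).iterated_deriv 4).continuousOn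
  have hsub : (Set.Icc 1 2 ×ℂ Set.Icc (-4) 4) ⊆ {s : ℂ | riemannZeta₁ s ≠ 0} := by
    intro s hs
    rcases eq_or_ne s 1 with rfl | h1
    · simp
    · exact riemannZeta₁_ne_zero h1 (riemannZeta_ne_zero_of_one_le_re hs.1.1)
  obtain ⟨M, hM⟩ := (isCompact_Icc.reProdIm isCompact_Icc).exists_bound_of_continuousOn
    (hcont.mono hsub)
  refine ⟨max C M, le_max_of_le_left hC0, fun s hs hs2 => ?_⟩
  have h1 : (1 : ℝ) ≤ (1 + s.im ^ 2) ^ (1 / 4 : ℝ) :=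
    Real.one_le_rpow (by nlinarith [sq_nonneg s.im]) (by norm_num)
  rcases le_total 4 |s.im| with h | h
  · refine (hC s hs hs2 h).trans ?_
    have h2 : |s.im| ^ (1 / 2 : ℝ) = (|s.im| ^ 2) ^ (1 / 4 : ℝ) := by
      rw [← Real.rpow_natCast, ← Real.rpow_mul (abs_nonneg _)]
      norm_num
    rw [h2, sq_abs]
    gcongr
    · exact le_max_left _ _
    · linarith
  · have hm := hM s ⟨⟨hs.le, hs2⟩, abs_le.1 h⟩
    have hM0 : 0 ≤ max C M := le_max_of_le_left hC0
    calc _ ≤ M := hm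
      _ ≤ max C M := le_max_right _ _
      _ ≤ _ := le_mul_of_one_le_right hM0 h1

/-- The Fejér-type weight `max (1 - x) 0` on `x > 0`, as a function with a computable Mellin
transform. -/
noncomputable def fejerWeight (x : ℝ) : ℂ :=
  (Set.Ioc (0 : ℝ) 1).indicator (fun _ : ℝ => (1 : ℂ)) x -
    (Set.Ioc (0 : ℝ) 1).indicator (fun t : ℝ => (t : ℂ) ^ (1 : ℂ)) x

lemma fejerWeight_eq {x : ℝ} (hx : 0 < x) : fejerWeight x = ((max (1 - x) 0 : ℝ) : ℂ) := by
  unfold fejerWeight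
  by_cases h : x ≤ 1
  · have hmem : x ∈ Set.Ioc (0 : ℝ) 1 := ⟨hx, h⟩
    rw [Set.indicator_of_mem hmem, Set.indicator_of_mem hmem, max_eq_left (by linarith)]
    simp
  · rw [Set.indicator_of_notMem (fun h' => h h'.2), Set.indicator_of_notMem (fun h' => h h'.2),
      max_eq_right (by linarith)]
    simp

lemma hasMellin_fejerWeight {s : ℂ} (hs : 0 < s.re) :
    HasMellin fejerWeight s (1 / s - 1 / (s + 1)) := by
  have h1 := hasMellin_one_Ioc hs
  have h2 := hasMellin_cpow_Ioc 1 (s := s) (by simp; linarith)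
  have := hasMellin_sub h1.1 h2.1
  rwa [h1.2, h2.2] at this

lemma norm_one_div_sub_one_div_le {σ : ℝ} (hσ : 1 ≤ σ) (y : ℝ) :
    ‖1 / (σ + y * Complex.I : ℂ) - 1 / (σ + y * Complex.I + 1)‖ ≤ (1 + y ^ 2)⁻¹ := by
  set s : ℂ := σ + y * Complex.I with hs
  have hre : s.re = σ := by simp [hs]
  have him : s.im = y := by simp [hs]
  have h1 : s ≠ 0 := by intro h; rw [h, Complex.zero_re] at hre; linarith
  have h2 : s + 1 ≠ 0 := by
    intro h; have := congrArg Complex.re h; simp [hre] at this; linarith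
  have h3 : 1 / s - 1 / (s + 1) = (s * (s + 1))⁻¹ := by field_simp; ring
  rw [h3, norm_inv, norm_mul]
  have h4 : ‖s‖ ≤ ‖s + 1‖ := by
    refine le_of_sq_le_sq ?_ (norm_nonneg _)
    rw [Complex.sq_norm, Complex.sq_norm, Complex.normSq_apply, Complex.normSq_apply]
    simp only [Complex.add_re, Complex.add_im, Complex.one_re, Complex.one_im, hre, him]
    nlinarith
  have h5 : 1 + y ^ 2 ≤ ‖s‖ ^ 2 := by
    rw [Complex.sq_norm, Complex.normSq_apply, hre, him]
    nlinarith
  gcongr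
  nlinarith [norm_nonneg s]

lemma continuous_fejerKernel {σ : ℝ} (hσ : 1 ≤ σ) :
    Continuous fun y : ℝ => 1 / (σ + y * Complex.I : ℂ) - 1 / (σ + y * Complex.I + 1) := by
  refine Continuous.sub (Continuous.div continuous_const (by fun_prop) fun y h => ?_)
    (Continuous.div continuous_const (by fun_prop) fun y h => ?_)
  · have := congrArg Complex.re h; simp at this; linarith
  · have := congrArg Complex.re h; simp at this; linarith

lemma mellinInv_fejerKernel {σ : ℝ} (hσ : 1 ≤ σ) {x : ℝ} (hx : 0 < x) :
    mellinInv σ (fun s => 1 / s - 1 / (s + 1)) x = ((max (1 - x) 0 : ℝ) : ℂ) := by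
  have hm : ∀ y : ℝ, mellin fejerWeight (σ + y * Complex.I) =
      1 / (σ + y * Complex.I : ℂ) - 1 / (σ + y * Complex.I + 1) := fun y =>
    (hasMellin_fejerWeight (by simp; linarith)).2
  rw [← fejerWeight_eq hx, ← mellinInv_mellin_eq σ fejerWeight hx
    (hasMellin_fejerWeight (by simp; linarith)).1]
  · simp only [mellinInv, hm]
  · simp only [Complex.VerticalIntegrable, hm]
    exact integrable_inv_one_add_sq.mono' (continuous_fejerKernel hσ).aestronglyMeasurable
      (Eventually.of_forall fun y => norm_one_div_sub_one_div_le hσ y)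
  · have : ContinuousAt (fun x : ℝ => ((max (1 - x) 0 : ℝ) : ℂ)) x := by fun_prop
    refine this.congr ?_
    filter_upwards [lt_mem_nhds hx] with t ht using (fejerWeight_eq ht).symm

open LSeries ArithmeticFunction in
lemma hasSum_fejer {a : ℕ → ℂ} (ha0 : a 0 = 0) {σ : ℝ} (hσ : 1 ≤ σ) (ha : LSeriesSummable a σ)
    {X : ℝ} (hX : 0 < X) :
    HasSum (fun n : ℕ => a n * ((max (1 - n / X) 0 : ℝ) : ℂ))
      ((1 / (2 * Real.pi)) • ∫ y : ℝ, LSeries a (σ + y * Complex.I) *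
        ((X : ℂ) ^ (σ + y * Complex.I : ℂ) *
          (1 / (σ + y * Complex.I : ℂ) - 1 / (σ + y * Complex.I + 1)))) := by
  set k : ℝ → ℂ := fun y => (X : ℂ) ^ (σ + y * Complex.I : ℂ) *
    (1 / (σ + y * Complex.I : ℂ) - 1 / (σ + y * Complex.I + 1)) with hk
  have hX0 : (X : ℂ) ≠ 0 := by exact_mod_cast hX.ne'
  have hline : Continuous fun y : ℝ => (σ + y * Complex.I : ℂ) := by fun_prop
  have hkc : Continuous k := (hline.const_cpow (Or.inl hX0)).mul (continuous_fejerKernel hσ)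
  have hki : MeasureTheory.Integrable k := by
    refine (integrable_inv_one_add_sq.const_mul (X ^ σ)).mono' hkc.aestronglyMeasurable
      (Eventually.of_forall fun y => ?_)
    rw [hk]
    simp only
    rw [norm_mul, Complex.norm_cpow_eq_rpow_re_of_pos hX]
    have hre : (σ + y * Complex.I : ℂ).re = σ := by simp
    rw [hre]
    gcongr
    exact norm_one_div_sub_one_div_le hσ y
  have hterm : ∀ (n : ℕ) (y : ℝ), ‖term a (σ + y * Complex.I) n‖ = ‖term a σ n‖ := by
    intro n y
    rw [norm_term_eq, norm_term_eq]
    simp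
  have htermc : ∀ n : ℕ, Continuous fun y : ℝ => term a (σ + y * Complex.I) n := by
    intro n
    rcases eq_or_ne n 0 with rfl | hn
    · simpa using continuous_const
    · have hn0 : (n : ℂ) ≠ 0 := by exact_mod_cast hn
      simp only [term_of_ne_zero hn]
      exact continuous_const.div (hline.const_cpow (Or.inl hn0)) fun y => by
        simp [Complex.cpow_eq_zero_iff, hn0]
  have h1 := MeasureTheory.hasSum_integral_of_summable_integral_norm (μ := MeasureTheory.volume)
    (F := fun (n : ℕ) (y : ℝ) => term a (σ + y * Complex.I) n * k y)
    (fun n => by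
      refine (hki.norm.const_mul ‖term a σ n‖).mono'
        ((htermc n).mul hkc).aestronglyMeasurable (Eventually.of_forall fun y => ?_)
      rw [norm_mul, hterm])
    (by
      simp only [norm_mul, hterm, MeasureTheory.integral_const_mul]
      exact ha.norm.mul_right _)
  simp only [tsum_mul_right] at h1
  refine (congrArg (fun f => HasSum f _) (funext fun n => ?_)).mpr
    (h1.const_smul (1 / (2 * Real.pi)))
  rcases eq_or_ne n 0 with rfl | hn
  · simp [ha0]
  have hnX : (0 : ℝ) < n / X := by positivity
  have hn0 : (n : ℂ) ≠ 0 := by exact_mod_cast hn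
  rw [← mellinInv_fejerKernel hσ hnX, mellinInv, mul_smul_comm,
    ← MeasureTheory.integral_const_mul]
  congr 2
  funext y
  rw [term_of_ne_zero hn, hk]
  have : ((n / X : ℝ) : ℂ) ^ (-(σ + y * Complex.I : ℂ)) =
      (X : ℂ) ^ (σ + y * Complex.I : ℂ) / (n : ℂ) ^ (σ + y * Complex.I : ℂ) := by
    rw [Complex.cpow_neg, Complex.ofReal_div, Complex.div_cpow_ofReal_nonneg _ hX.le, inv_div]
    · simp
    · positivity
  simp only [smul_eq_mul, this]
  ring

open LSeries ArithmeticFunction in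
lemma LSeriesSummable_vonMangoldt_sub_one {s : ℂ} (hs : 1 < s.re) :
    LSeriesSummable (fun n => (vonMangoldt n : ℂ) - 1) s :=
  (LSeriesSummable_vonMangoldt hs).sub (LSeriesSummable_one_iff.mpr hs)

open LSeries ArithmeticFunction in
lemma LSeries_vonMangoldt_sub_one {s : ℂ} (hs : 1 < s.re) :
    LSeries (fun n => (vonMangoldt n : ℂ) - 1) s = zetaDiff s := by
  have h0 : s ≠ 1 := by rintro rfl; simp at hs
  rw [zetaDiff_eq h0 (riemannZeta_ne_zero_of_one_lt_re hs),
    ← LSeries_vonMangoldt_eq_deriv_riemannZeta_div hs, ← LSeries_one_eq_riemannZeta hs,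
    ← LSeries_sub (LSeriesSummable_vonMangoldt hs) (LSeriesSummable_one_iff.mpr hs)]
  rfl

open LSeries in
lemma abscissaOfAbsConv_vonMangoldt_sub_one_le :
    abscissaOfAbsConv (fun n => (ArithmeticFunction.vonMangoldt n : ℂ) - 1) ≤ 1 := by
  refine abscissaOfAbsConv_le_of_forall_lt_LSeriesSummable (x := 1) fun y hy => ?_
  exact LSeriesSummable_vonMangoldt_sub_one (by simpa using hy)

/-- The coefficients `(Λ n - 1) (log n) ^ 4`. -/
noncomputable def mangoldtCoeff (n : ℕ) : ℝ :=
  (ArithmeticFunction.vonMangoldt n - 1) * Real.log n ^ 4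

lemma logMul_iterate_vonMangoldt_sub_one :
    LSeries.logMul^[4] (fun n => (ArithmeticFunction.vonMangoldt n : ℂ) - 1) =
      fun n => (mangoldtCoeff n : ℂ) := by
  funext n
  simp only [Function.iterate_succ, Function.iterate_zero, Function.comp_apply, id,
    LSeries.logMul, mangoldtCoeff]
  push_cast
  ring

lemma LSeriesSummable_mangoldtCoeff {s : ℂ} (hs : 1 < s.re) :
    LSeriesSummable (fun n => (mangoldtCoeff n : ℂ)) s := by
  rw [← logMul_iterate_vonMangoldt_sub_one]
  refine LSeriesSummable_of_abscissaOfAbsConv_lt_re ?_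
  rw [LSeries.absicssaOfAbsConv_logPowMul]
  exact abscissaOfAbsConv_vonMangoldt_sub_one_le.trans_lt (by exact_mod_cast hs)

lemma LSeries_mangoldtCoeff {s : ℂ} (hs : 1 < s.re) :
    LSeries (fun n => (mangoldtCoeff n : ℂ)) s = iteratedDeriv 4 zetaDiff s := by
  have h := LSeries_iteratedDeriv (f := fun n => (ArithmeticFunction.vonMangoldt n : ℂ) - 1) 4
    (s := s) (abscissaOfAbsConv_vonMangoldt_sub_one_le.trans_lt (by exact_mod_cast hs))
  rw [logMul_iterate_vonMangoldt_sub_one] at h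
  have h2 : LSeries (fun n => (ArithmeticFunction.vonMangoldt n : ℂ) - 1) =ᶠ[nhds s] zetaDiff := by
    filter_upwards [(isOpen_lt continuous_const Complex.continuous_re).mem_nhds hs] with z hz
    exact LSeries_vonMangoldt_sub_one hz
  rw [h2.iteratedDeriv_eq] at h
  rw [h]
  norm_num

lemma exists_abs_sum_mangoldtCoeff_mul_le : ∃ C : ℝ, 0 ≤ C ∧ ∀ X : ℕ, 3 ≤ X →
    |∑ n ∈ Finset.range X, mangoldtCoeff n * ((X : ℝ) - n)| ≤ C * (X : ℝ) ^ 2 := by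
  obtain ⟨C, hC0, hC⟩ := exists_norm_iteratedDeriv_zetaDiff_le
  have hJint : MeasureTheory.Integrable fun y : ℝ => (1 + y ^ 2) ^ (-(3 / 4) : ℝ) := by
    have := integrable_rpow_neg_one_add_norm_sq (E := ℝ) (μ := MeasureTheory.volume)
      (r := 3 / 2) (by simp; norm_num)
    refine this.congr (Eventually.of_forall fun y => ?_)
    simp only [Real.norm_eq_abs, sq_abs]
    norm_num
  set J := ∫ y : ℝ, (1 + y ^ 2) ^ (-(3 / 4) : ℝ) with hJ
  have hJ0 : 0 ≤ J := MeasureTheory.integral_nonneg fun y => by positivity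
  refine ⟨1 / (2 * Real.pi) * (C * Real.exp 1 * J), by positivity, fun X hX => ?_⟩
  have hX3 : (3 : ℝ) ≤ X := by exact_mod_cast hX
  have hX0 : (0 : ℝ) < X := by linarith
  have hlog : 1 ≤ Real.log X := by
    rw [Real.le_log_iff_exp_le hX0]
    linarith [Real.exp_one_lt_d9]
  set σ : ℝ := 1 + 1 / Real.log X with hσ
  have hσ1 : 1 < σ := by
    have : 0 < 1 / Real.log X := by positivity
    linarith
  have hσ2 : σ ≤ 2 := by
    have : 1 / Real.log X ≤ 1 := by rw [div_le_one (by linarith)]; exact hlog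
    linarith
  have hXσ : (X : ℝ) ^ σ = Real.exp 1 * X := by
    rw [hσ, Real.rpow_add hX0, Real.rpow_one, Real.rpow_def_of_pos hX0,
      mul_one_div_cancel (by linarith), mul_comm]
  have hs := hasSum_fejer (a := fun n => (mangoldtCoeff n : ℂ)) (by simp [mangoldtCoeff]) hσ1.le
    (LSeriesSummable_mangoldtCoeff (by simpa using hσ1)) hX0
  have hs2 : HasSum (fun n : ℕ => (mangoldtCoeff n : ℂ) * ((max (1 - n / X) 0 : ℝ) : ℂ))
      (∑ n ∈ Finset.range X, (mangoldtCoeff n : ℂ) * ((max (1 - n / X) 0 : ℝ) : ℂ)) := by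
    refine hasSum_sum_of_ne_finset_zero fun n hn => ?_
    have : (X : ℝ) ≤ n := by simpa using hn
    rw [max_eq_right]
    · simp
    · rw [sub_nonpos, one_le_div hX0]; exact this
  have heq := hs2.unique hs
  have h1 : ((∑ n ∈ Finset.range X, mangoldtCoeff n * ((X : ℝ) - n) : ℝ) : ℂ) =
      X * ∑ n ∈ Finset.range X, (mangoldtCoeff n : ℂ) * ((max (1 - n / X) 0 : ℝ) : ℂ) := by
    rw [Finset.mul_sum]
    push_cast
    refine Finset.sum_congr rfl fun n hn => ?_
    have h2 : (n : ℝ) ≤ X := by exact_mod_cast (Finset.mem_range.mp hn).le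
    rw [max_eq_left (by rw [sub_nonneg, div_le_one hX0]; exact h2)]
    have : (X : ℂ) ≠ 0 := by exact_mod_cast hX0.ne'
    push_cast
    field_simp
  have hI : ‖∫ y : ℝ, LSeries (fun n => (mangoldtCoeff n : ℂ)) (σ + y * Complex.I) *
        (((X : ℝ) : ℂ) ^ (σ + y * Complex.I : ℂ) *
          (1 / (σ + y * Complex.I : ℂ) - 1 / (σ + y * Complex.I + 1)))‖ ≤
      C * Real.exp 1 * J * X := by
    have h3 : C * Real.exp 1 * J * X = ∫ y : ℝ, C * (Real.exp 1 * X) *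
        (1 + y ^ 2) ^ (-(3 / 4) : ℝ) := by
      rw [MeasureTheory.integral_const_mul]; ring
    rw [h3]
    refine MeasureTheory.norm_integral_le_of_norm_le (hJint.const_mul _)
      (Eventually.of_forall fun y => ?_)
    have hre : (σ + y * Complex.I : ℂ).re = σ := by simp
    have him : (σ + y * Complex.I : ℂ).im = y := by simp
    rw [norm_mul, norm_mul, Complex.norm_cpow_eq_rpow_re_of_pos hX0, hre, hXσ,
      LSeries_mangoldtCoeff (by rw [hre]; exact hσ1)]
    have h4 := hC (σ + y * Complex.I) (by rw [hre]; exact hσ1) (by rw [hre]; exact hσ2)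
    rw [him] at h4
    have h5 : (1 + y ^ 2) ^ (-(3 / 4) : ℝ) = (1 + y ^ 2) ^ (1 / 4 : ℝ) * (1 + y ^ 2)⁻¹ := by
      rw [← Real.rpow_neg_one, ← Real.rpow_add (by positivity)]
      norm_num
    rw [h5]
    calc _ ≤ C * (1 + y ^ 2) ^ (1 / 4 : ℝ) * (Real.exp 1 * X * (1 + y ^ 2)⁻¹) := by
          gcongr
          exact norm_one_div_sub_one_div_le hσ1.le y
      _ = _ := by ring
  have h6 : |∑ n ∈ Finset.range X, mangoldtCoeff n * ((X : ℝ) - n)| =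
      ‖((∑ n ∈ Finset.range X, mangoldtCoeff n * ((X : ℝ) - n) : ℝ) : ℂ)‖ := by
    rw [Complex.norm_real, Real.norm_eq_abs]
  rw [h6, h1, heq, norm_mul, norm_smul, Complex.norm_natCast, Real.norm_of_nonneg (by positivity)]
  calc _ ≤ (X : ℝ) * (1 / (2 * Real.pi) * (C * Real.exp 1 * J * X)) := by gcongr
    _ = _ := by ring

lemma neg_log_pow_le_mangoldtCoeff (n : ℕ) : -Real.log n ^ 4 ≤ mangoldtCoeff n := by
  have h1 : 0 ≤ ArithmeticFunction.vonMangoldt n := ArithmeticFunction.vonMangoldt_nonneg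
  have h2 : 0 ≤ ArithmeticFunction.vonMangoldt n * Real.log n ^ 4 := by positivity
  unfold mangoldtCoeff
  linarith

lemma mul_sum_mangoldtCoeff_le (M y : ℕ) :
    y * ∑ n ∈ Finset.range M, mangoldtCoeff n ≤
      (∑ n ∈ Finset.range (M + y), mangoldtCoeff n * (((M + y : ℕ) : ℝ) - n)) -
        (∑ n ∈ Finset.range M, mangoldtCoeff n * ((M : ℝ) - n)) +
        y * (y * Real.log (M + y : ℕ) ^ 4) := by
  rw [Finset.sum_range_add]
  have h1 : ∑ n ∈ Finset.range M, mangoldtCoeff n * (((M + y : ℕ) : ℝ) - n) =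
      ∑ n ∈ Finset.range M, mangoldtCoeff n * ((M : ℝ) - n) +
        y * ∑ n ∈ Finset.range M, mangoldtCoeff n := by
    rw [Finset.mul_sum, ← Finset.sum_add_distrib]
    refine Finset.sum_congr rfl fun n _ => ?_
    push_cast
    ring
  have h2 : ∑ _x ∈ Finset.range y, -(y * Real.log (M + y : ℕ) ^ 4) ≤
      ∑ x ∈ Finset.range y, mangoldtCoeff (M + x) * (((M + y : ℕ) : ℝ) - (M + x : ℕ)) := by
    refine Finset.sum_le_sum fun x hx => ?_
    have hxy : (x : ℝ) ≤ y := by exact_mod_cast (Finset.mem_range.mp hx).le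
    have h3 : (((M + y : ℕ) : ℝ) - (M + x : ℕ)) = y - x := by push_cast; ring
    rw [h3]
    have h4 := neg_log_pow_le_mangoldtCoeff (M + x)
    have hlog0 : 0 ≤ Real.log (M + x : ℕ) := Real.log_natCast_nonneg _
    have h5 : Real.log (M + x : ℕ) ^ 4 ≤ Real.log (M + y : ℕ) ^ 4 := by
      rcases Nat.eq_zero_or_pos (M + x) with h | h
      · rw [h]; simp
        exact pow_nonneg (by exact_mod_cast Real.log_natCast_nonneg (M + y)) 4
      · gcongr
        exact (Finset.mem_range.mp hx).le
    have hx0 : (0 : ℝ) ≤ x := by positivity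
    have h6 : 0 ≤ Real.log (M + y : ℕ) ^ 4 := pow_nonneg (Real.log_natCast_nonneg _) 4
    calc -(y * Real.log (M + y : ℕ) ^ 4) ≤ -Real.log (M + y : ℕ) ^ 4 * (y - x) := by nlinarith
      _ ≤ _ := mul_le_mul_of_nonneg_right (by linarith) (by linarith)
  rw [Finset.sum_const, Finset.card_range, nsmul_eq_mul] at h2
  rw [h1]
  linarith

lemma exists_sum_mangoldtCoeff_le : ∃ C : ℝ, 0 ≤ C ∧ ∀ M : ℕ, 3 ≤ M →
    ∑ n ∈ Finset.range M, mangoldtCoeff n ≤ C * (M * Real.log M ^ 2) := by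
  obtain ⟨C, hC0, hC⟩ := exists_abs_sum_mangoldtCoeff_mul_le
  refine ⟨5 * C + 80, by positivity, fun M hM => ?_⟩
  have hM3 : (3 : ℝ) ≤ M := by exact_mod_cast hM
  have hM0 : (0 : ℝ) < M := by linarith
  have hlog : 1 ≤ Real.log M := by
    rw [Real.le_log_iff_exp_le hM0]
    linarith [Real.exp_one_lt_d9]
  have hlog2 : Real.log M ^ 2 ≤ 4 * M := by
    have h1 : Real.log M = 2 * Real.log (Real.sqrt M) := by rw [Real.log_sqrt hM0.le]; ring
    have h2 : Real.log (Real.sqrt M) ≤ Real.sqrt M :=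
      (Real.log_le_sub_one_of_pos (Real.sqrt_pos.mpr hM0)).trans (by linarith)
    have h3 : 0 ≤ Real.log (Real.sqrt M) := by linarith
    have h4 := Real.sq_sqrt hM0.le
    rw [h1]
    nlinarith
  set L := Real.log M with hL
  set y := ⌈(M : ℝ) / L ^ 2⌉₊ with hy
  have hL2 : 1 ≤ L ^ 2 := one_le_pow₀ hlog
  have hy1 : M / L ^ 2 ≤ y := Nat.le_ceil _
  have hy0 : (0 : ℝ) < y := lt_of_lt_of_le (by positivity) hy1
  have hyM : y ≤ M := by
    rw [hy, Nat.ceil_le]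
    exact div_le_self hM0.le hL2
  have hyM' : (y : ℝ) ≤ M := by exact_mod_cast hyM
  have hy2 : y ≤ 5 * (M / L ^ 2) := by
    have h1 : (y : ℝ) < M / L ^ 2 + 1 := Nat.ceil_lt_add_one (by positivity)
    have h2 : 1 ≤ 4 * (M / L ^ 2) := by
      rw [← mul_div_assoc, one_le_div (by positivity)]; exact hlog2
    linarith
  have hlogMy : Real.log (M + y : ℕ) ≤ 2 * L := by
    have : ((M + y : ℕ) : ℝ) ≤ (M : ℝ) ^ 2 := by push_cast; nlinarith
    calc _ ≤ Real.log ((M : ℝ) ^ 2) := Real.log_le_log (by push_cast; positivity) this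
      _ = _ := by rw [hL, Real.log_pow]; norm_num
  have hW1 := (abs_le.mp (hC (M + y) (by omega))).2
  have hW2 := (abs_le.mp (hC M hM)).1
  have hmain := mul_sum_mangoldtCoeff_le M y
  set R := ∑ n ∈ Finset.range M, mangoldtCoeff n
  have hsq : (((M + y : ℕ) : ℝ)) ^ 2 ≤ 4 * (M : ℝ) ^ 2 := by push_cast; nlinarith
  have h4 : Real.log (M + y : ℕ) ^ 4 ≤ (2 * L) ^ 4 :=
    pow_le_pow_left₀ (Real.log_natCast_nonneg _) hlogMy 4
  have hMy : (M : ℝ) ^ 2 ≤ y * (M * L ^ 2) := by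
    rw [div_le_iff₀ (by positivity)] at hy1
    nlinarith
  have h5 : (y : ℝ) * Real.log (M + y : ℕ) ^ 4 ≤ 80 * (M * L ^ 2) := by
    calc (y : ℝ) * Real.log (M + y : ℕ) ^ 4 ≤ (5 * (M / L ^ 2)) * (2 * L) ^ 4 := by gcongr
      _ = _ := by field_simp; ring
  have h6 : y * R ≤ y * ((5 * C + 80) * (M * L ^ 2)) := by
    calc y * R ≤ 5 * C * (M : ℝ) ^ 2 + y * (y * Real.log (M + y : ℕ) ^ 4) := by nlinarith
      _ ≤ 5 * C * (y * (M * L ^ 2)) + y * (80 * (M * L ^ 2)) := by gcongr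
      _ = _ := by ring
  exact le_of_mul_le_mul_left h6 hy0

lemma sum_Ico_mul_eq_of_range (c w : ℕ → ℝ) {m M : ℕ} (hM : m ≤ M) :
    ∑ n ∈ Finset.Ico m M, c n * w n =
      (∑ n ∈ Finset.range M, c n) * w M - (∑ n ∈ Finset.range m, c n) * w m +
        ∑ n ∈ Finset.Ico m M, (∑ k ∈ Finset.range (n + 1), c k) * (w n - w (n + 1)) := by
  induction M, hM using Nat.le_induction with
  | base => simp
  | succ M hM ih =>
    rw [Finset.sum_Ico_succ_top hM, Finset.sum_Ico_succ_top hM, ih, Finset.sum_range_succ]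
    ring

lemma inv_log_pow_sub_le {n : ℕ} (hn : 3 ≤ n) :
    (Real.log n ^ 5)⁻¹ - (Real.log (n + 1 : ℕ) ^ 5)⁻¹ ≤ 5 / (n * Real.log n ^ 6) := by
  have hn3 : (3 : ℝ) ≤ n := by exact_mod_cast hn
  have hn0 : (0 : ℝ) < n := by linarith
  have ha : 0 < Real.log n := Real.log_pos (by linarith)
  have hab : Real.log n ≤ Real.log (n + 1 : ℕ) := Real.log_le_log hn0 (by push_cast; linarith)
  have hd : Real.log (n + 1 : ℕ) - Real.log n ≤ 1 / n := by
    rw [← Real.log_div (by positivity) hn0.ne']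
    refine (Real.log_le_sub_one_of_pos (by positivity)).trans (le_of_eq ?_)
    push_cast
    field_simp
    ring
  set a := Real.log n
  set b := Real.log (n + 1 : ℕ)
  have hb : 0 < b := ha.trans_le hab
  have h1 : b ^ 5 - a ^ 5 ≤ 5 * b ^ 4 * (b - a) := by
    have : b ^ 5 - a ^ 5 = (b ^ 4 + b ^ 3 * a + b ^ 2 * a ^ 2 + b * a ^ 3 + a ^ 4) * (b - a) := by
      ring
    rw [this]
    refine mul_le_mul_of_nonneg_right ?_ (by linarith)
    have e1 : b ^ 3 * a ≤ b ^ 3 * b := by gcongr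
    have e2 : b ^ 2 * a ^ 2 ≤ b ^ 2 * b ^ 2 := by gcongr
    have e3 : b * a ^ 3 ≤ b * b ^ 3 := by gcongr
    have e4 : a ^ 4 ≤ b ^ 4 := by gcongr
    linarith
  calc (a ^ 5)⁻¹ - (b ^ 5)⁻¹ = (b ^ 5 - a ^ 5) / (a ^ 5 * b ^ 5) := by field_simp
    _ ≤ (5 * b ^ 4 * (1 / n)) / (a ^ 5 * b ^ 5) := by
        gcongr
        exact h1.trans (by gcongr)
    _ = 5 / (n * (a ^ 5 * b)) := by field_simp
    _ ≤ 5 / (n * a ^ 6) := by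
        gcongr
        calc a ^ 6 = a ^ 5 * a := by ring
          _ ≤ _ := by gcongr

lemma exists_sum_mangoldtCoeff_div_log_pow_le : ∃ C : ℝ, 0 ≤ C ∧ ∀ M : ℕ, 3 ≤ M →
    ∑ n ∈ Finset.Ico 3 M, mangoldtCoeff n * (Real.log n ^ 5)⁻¹ ≤
      C + C * (M / Real.log M ^ 3) + C * ∑ n ∈ Finset.Ico 3 M, 1 / Real.log n ^ 4 := by
  obtain ⟨C, hC0, hC⟩ := exists_sum_mangoldtCoeff_le
  set K := -((∑ n ∈ Finset.range 3, mangoldtCoeff n) * (Real.log (3 : ℕ) ^ 5)⁻¹) with hK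
  refine ⟨max K (40 * C), le_max_of_le_right (by positivity), fun M hM => ?_⟩
  have hlogpos : ∀ n : ℕ, 3 ≤ n → 0 < Real.log n := fun n hn =>
    Real.log_pos (by exact_mod_cast (by omega : 1 < n))
  have hM0 := hlogpos M hM
  rw [sum_Ico_mul_eq_of_range mangoldtCoeff (fun n => (Real.log n ^ 5)⁻¹) hM]
  have h1 : (∑ n ∈ Finset.range M, mangoldtCoeff n) * (Real.log M ^ 5)⁻¹ ≤
      40 * C * (M / Real.log M ^ 3) := by
    calc _ ≤ C * (M * Real.log M ^ 2) * (Real.log M ^ 5)⁻¹ := by gcongr; exact hC M hM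
      _ = C * (M / Real.log M ^ 3) := by field_simp
      _ ≤ 40 * C * (M / Real.log M ^ 3) := by gcongr; linarith
  have h2 : ∑ n ∈ Finset.Ico 3 M, (∑ k ∈ Finset.range (n + 1), mangoldtCoeff k) *
      ((Real.log n ^ 5)⁻¹ - (Real.log (n + 1 : ℕ) ^ 5)⁻¹) ≤
      40 * C * ∑ n ∈ Finset.Ico 3 M, 1 / Real.log n ^ 4 := by
    rw [Finset.mul_sum]
    refine Finset.sum_le_sum fun n hn => ?_
    have hn3 := (Finset.mem_Ico.mp hn).1
    have hn3' : (3 : ℝ) ≤ n := by exact_mod_cast hn3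
    have hn0 := hlogpos n hn3
    have hdiff : 0 ≤ (Real.log n ^ 5)⁻¹ - (Real.log (n + 1 : ℕ) ^ 5)⁻¹ := by
      rw [sub_nonneg]
      gcongr
      omega
    have hlog : Real.log (n + 1 : ℕ) ≤ 2 * Real.log n := by
      have : ((n + 1 : ℕ) : ℝ) ≤ (n : ℝ) ^ 2 := by push_cast; nlinarith
      calc _ ≤ Real.log ((n : ℝ) ^ 2) := Real.log_le_log (by push_cast; positivity) this
        _ = _ := by rw [Real.log_pow]; norm_num
    have h0 := Real.log_natCast_nonneg (n + 1)
    calc _ ≤ C * ((n + 1 : ℕ) * Real.log (n + 1 : ℕ) ^ 2) *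
          ((Real.log n ^ 5)⁻¹ - (Real.log (n + 1 : ℕ) ^ 5)⁻¹) :=
          mul_le_mul_of_nonneg_right (hC (n + 1) (by omega)) hdiff
      _ ≤ C * ((2 * n) * (2 * Real.log n) ^ 2) * (5 / (n * Real.log n ^ 6)) := by
          gcongr
          · push_cast; linarith
          · exact inv_log_pow_sub_le hn3
      _ = 40 * C * (1 / Real.log n ^ 4) := by field_simp; ring
  have hs : 0 ≤ ∑ n ∈ Finset.Ico 3 M, 1 / Real.log n ^ 4 :=
    Finset.sum_nonneg fun n hn => by
      have := hlogpos n (Finset.mem_Ico.mp hn).1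
      positivity
  have h3 : 40 * C * ∑ n ∈ Finset.Ico 3 M, 1 / Real.log n ^ 4 ≤
      max K (40 * C) * ∑ n ∈ Finset.Ico 3 M, 1 / Real.log n ^ 4 := by
    gcongr
    exact le_max_right _ _
  have h4 : 40 * C * (M / Real.log M ^ 3) ≤ max K (40 * C) * (M / Real.log M ^ 3) := by
    gcongr
    exact le_max_right _ _
  have h5 := le_max_left K (40 * C)
  linarith

lemma primeCounting'_le_sum_vonMangoldt_div_log {M : ℕ} (hM : 3 ≤ M) :
    (Nat.primeCounting' M : ℝ) ≤
      1 + ∑ n ∈ Finset.Ico 3 M, ArithmeticFunction.vonMangoldt n / Real.log n := by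
  induction M, hM using Nat.le_induction with
  | base =>
    have : Nat.primeCounting' 3 = 1 := by decide
    simp [this]
  | succ M hM ih =>
    have hlog : 0 < Real.log M := Real.log_pos (by exact_mod_cast (by omega : 1 < M))
    rw [Finset.sum_Ico_succ_top hM, Nat.primeCounting', Nat.count_succ]
    rw [Nat.primeCounting'] at ih
    rw [Nat.cast_add]
    split_ifs with hp
    · rw [ArithmeticFunction.vonMangoldt_apply_prime hp, div_self hlog.ne']
      linarith
    · have : 0 ≤ ArithmeticFunction.vonMangoldt M / Real.log M :=
        div_nonneg ArithmeticFunction.vonMangoldt_nonneg hlog.le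
      linarith

/-- The first three terms of the asymptotic expansion of the logarithmic integral, with the third
coefficient left free. -/
noncomputable def liApprox (C x : ℝ) : ℝ :=
  x / Real.log x + x / Real.log x ^ 2 + C * (x / Real.log x ^ 3)

lemma hasDerivAt_liApprox (C : ℝ) {x : ℝ} (hx : 1 < x) :
    HasDerivAt (liApprox C) (1 / Real.log x + (C - 2) / Real.log x ^ 3 -
      3 * C / Real.log x ^ 4) x := by
  have hL : 0 < Real.log x := Real.log_pos hx
  have hx0 : x ≠ 0 := by linarith
  have hl := Real.hasDerivAt_log hx0
  have h1 := (hasDerivAt_id x).div hl hL.ne'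
  have h2 := (hasDerivAt_id x).div (hl.pow 2) (pow_pos hL 2).ne'
  have h3 := ((hasDerivAt_id x).div (hl.pow 3) (pow_pos hL 3).ne').const_mul C
  refine ((h1.add h2).add h3).congr_deriv ?_
  simp only [id, Pi.pow_apply]
  field_simp
  push_cast
  ring

lemma le_liApprox_sub {C c a b : ℝ} (hc : 0 ≤ c) (hC : 12 + c ≤ 3 * C) (ha : 1 < a)
    (hla : 6 ≤ Real.log a) (hab : a ≤ b) :
    (1 / Real.log b + c / Real.log b ^ 4) * (b - a) ≤ liApprox C b - liApprox C a := by
  rcases hab.eq_or_lt with rfl | hab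
  · simp
  obtain ⟨x, hx, hx2⟩ := exists_hasDerivAt_eq_slope (liApprox C) _ hab
    (fun x hx => (hasDerivAt_liApprox C (ha.trans_le hx.1)).continuousAt.continuousWithinAt)
    (fun x hx => hasDerivAt_liApprox C (ha.trans hx.1))
  rw [eq_div_iff (by linarith)] at hx2
  rw [← hx2]
  refine mul_le_mul_of_nonneg_right ?_ (by linarith)
  have hx0 : 0 < x := by linarith [hx.1]
  have hLx : 6 ≤ Real.log x := hla.trans (Real.log_le_log (by linarith) hx.1.le)
  have hLb : Real.log x ≤ Real.log b := Real.log_le_log hx0 hx.2.le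
  have hL0 : 0 < Real.log x := by linarith
  have h1 : 1 / Real.log b + c / Real.log b ^ 4 ≤ 1 / Real.log x + c / Real.log x ^ 4 := by
    gcongr
  have h2 : c / Real.log x ^ 4 ≤ (C - 2) / Real.log x ^ 3 - 3 * C / Real.log x ^ 4 := by
    rw [show (C - 2) / Real.log x ^ 3 - 3 * C / Real.log x ^ 4 =
      ((C - 2) * Real.log x - 3 * C) / Real.log x ^ 4 by field_simp]
    gcongr
    nlinarith
  linarith

lemma six_le_log_of_le {x : ℝ} (hx : 729 ≤ x) : 6 ≤ Real.log x := by
  rw [Real.le_log_iff_exp_le (by linarith)]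
  have h1 : Real.exp 6 = Real.exp 1 ^ 6 := by rw [← Real.exp_nat_mul]; norm_num
  have h2 : Real.exp 1 ≤ 3 := by linarith [Real.exp_one_lt_d9]
  have h3 : Real.exp 1 ^ 6 ≤ 3 ^ 6 := pow_le_pow_left₀ (Real.exp_pos 1).le h2 6
  norm_num at h3
  linarith

lemma exists_sum_le_liApprox {C c : ℝ} (hc : 0 ≤ c) (hC : 12 + c ≤ 3 * C) :
    ∃ K : ℝ, ∀ M : ℕ, 729 ≤ M →
      ∑ n ∈ Finset.Ico 3 M, (1 / Real.log n + c / Real.log n ^ 4) ≤ K + liApprox C M := by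
  set S : ℕ → ℝ := fun M => ∑ n ∈ Finset.Ico 3 M, (1 / Real.log n + c / Real.log n ^ 4) with hS
  have hpos : ∀ n : ℕ, 0 ≤ 1 / Real.log n + c / Real.log n ^ 4 := fun n => by
    have := Real.log_natCast_nonneg n
    positivity
  refine ⟨S 730 - liApprox C 729, fun M hM => ?_⟩
  have key : S (M + 1) ≤ S 730 - liApprox C 729 + liApprox C M := by
    induction M, hM using Nat.le_induction with
    | base => norm_num
    | succ M hM ih =>
      have hM' : (729 : ℝ) ≤ M := by exact_mod_cast hM
      have h1 : S (M + 1 + 1) = S (M + 1) +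
          (1 / Real.log (M + 1 : ℕ) + c / Real.log (M + 1 : ℕ) ^ 4) :=
        Finset.sum_Ico_succ_top (by omega) _
      have h2 := le_liApprox_sub hc hC (a := M) (b := (M + 1 : ℕ)) (by linarith)
        (six_le_log_of_le hM') (by push_cast; linarith)
      have h3 : ((M + 1 : ℕ) : ℝ) - M = 1 := by push_cast; ring
      rw [h3, mul_one] at h2
      linarith
  have h1 : S (M + 1) = S M + (1 / Real.log M + c / Real.log M ^ 4) :=
    Finset.sum_Ico_succ_top (by omega) _
  have := hpos M
  change S M ≤ _
  linarith

lemma exists_primeCounting'_add_one_le_liApprox : ∃ C : ℝ, 4 ≤ C ∧ ∀ᶠ M : ℕ in atTop,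
    (Nat.primeCounting' M : ℝ) + 1 ≤ liApprox C M := by
  obtain ⟨c, hc0, hc⟩ := exists_sum_mangoldtCoeff_div_log_pow_le
  obtain ⟨K, hK⟩ := exists_sum_le_liApprox (C := 4 + c) (c := c) hc0 (by linarith)
  refine ⟨4 + c + c + (2 + c + |K|), by linarith [abs_nonneg K], ?_⟩
  have hlog : ∀ᶠ M : ℕ in atTop, Real.log M ^ 3 ≤ M := by
    have h := (Real.isLittleO_pow_log_id_atTop (n := 3)).bound one_pos
    have h2 := tendsto_natCast_atTop_atTop (R := ℝ) |>.eventually h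
    filter_upwards [h2] with M hM
    simp only [id, Real.norm_eq_abs, one_mul] at hM
    rw [abs_of_nonneg (by positivity : (0 : ℝ) ≤ M)] at hM
    exact (le_abs_self _).trans hM
  filter_upwards [hlog, eventually_ge_atTop 729] with M hM1 hM
  have hlog0 : 0 < Real.log M := Real.log_pos (by exact_mod_cast (by omega : 1 < M))
  have h1 := primeCounting'_le_sum_vonMangoldt_div_log (show 3 ≤ M by omega)
  have h2 := hc M (by omega)
  have h3 := hK M hM
  have h4 : ∑ n ∈ Finset.Ico 3 M, ArithmeticFunction.vonMangoldt n / Real.log n =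
      ∑ n ∈ Finset.Ico 3 M, 1 / Real.log n +
        ∑ n ∈ Finset.Ico 3 M, mangoldtCoeff n * (Real.log n ^ 5)⁻¹ := by
    rw [← Finset.sum_add_distrib]
    refine Finset.sum_congr rfl fun n hn => ?_
    have : 0 < Real.log n := Real.log_pos (by
      exact_mod_cast (by have := (Finset.mem_Ico.mp hn).1; omega : 1 < n))
    rw [mangoldtCoeff]
    field_simp
    ring
  have h5 : ∑ n ∈ Finset.Ico 3 M, (1 / Real.log n + c / Real.log n ^ 4) =
      ∑ n ∈ Finset.Ico 3 M, 1 / Real.log n + c * ∑ n ∈ Finset.Ico 3 M, 1 / Real.log n ^ 4 := by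
    rw [Finset.mul_sum, ← Finset.sum_add_distrib]
    simp only [mul_one_div]
  have h6 : 1 ≤ M / Real.log M ^ 3 := by rw [one_le_div (by positivity)]; exact hM1
  have h7 : K ≤ |K| := le_abs_self K
  have h8 : 0 ≤ 2 + c + |K| := by positivity
  have h9 : 2 + c + |K| ≤ (2 + c + |K|) * (M / Real.log M ^ 3) := le_mul_of_one_le_right h8 h6
  unfold liApprox at h3 ⊢
  linarith

lemma le_nthPrime (n : ℕ) : n ≤ nthPrime n := by
  have := Nat.add_two_le_nth_prime (n - 1)
  unfold nthPrime
  omega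

lemma tendsto_nthPrime : Tendsto nthPrime atTop atTop :=
  tendsto_atTop_mono le_nthPrime tendsto_id

lemma primeCounting'_nthPrime_add_one {n : ℕ} (hn : 0 < n) :
    Nat.primeCounting' (nthPrime n) + 1 = n := by
  rw [nthPrime, Nat.primeCounting'_nth_eq]
  omega

lemma g_lt_g {a b : ℝ} (ha : 729 ≤ a) (hab : a < b) : g a < g b := by
  have h1 := six_le_log_of_le ha
  have h2 : Real.log a ≤ Real.log b := Real.log_le_log (by linarith) hab.le
  have h3 : Real.log (Real.log a) ≤ Real.log (Real.log b) := Real.log_le_log (by linarith) h2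
  have h4 : 0 ≤ Real.log (Real.log a) := Real.log_nonneg (by linarith)
  unfold g
  exact mul_lt_mul hab (by linarith) (by linarith) (by linarith)

lemma liApprox_le_liApprox {C a b : ℝ} (hC : 4 ≤ C) (ha : 729 ≤ a) (hab : a ≤ b) :
    liApprox C a ≤ liApprox C b := by
  have h := le_liApprox_sub le_rfl (by linarith : 12 + 0 ≤ 3 * C) (by linarith)
    (six_le_log_of_le ha) hab
  have h1 := six_le_log_of_le (ha.trans hab)
  have h2 : 0 ≤ (1 / Real.log b + 0 / Real.log b ^ 4) * (b - a) :=
    mul_nonneg (by rw [zero_div, add_zero]; positivity) (by linarith)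
  linarith

lemma le_g {x : ℝ} (hx : 729 ≤ x) : x ≤ g x := by
  have h1 := six_le_log_of_le hx
  have h2 : 0 ≤ Real.log (Real.log x) := Real.log_nonneg (by linarith)
  exact le_mul_of_one_le_right (by linarith) (by linarith)

lemma liApprox_g_lt {C x : ℝ} (hC : 0 ≤ C) (hx : 729 ≤ x)
    (hl : C + 1 < Real.log (Real.log x)) : liApprox C (g x) < x := by
  have hL := six_le_log_of_le hx
  have hx0 : 0 < x := by linarith
  set L := Real.log x with hLdef
  set l := Real.log L with hldef
  set D := L + l - 1 with hD
  have hD0 : 0 < D := by linarith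
  have hg : g x = x * D := rfl
  have hlog : D + 1 + (l - 1) / D ≤ Real.log (x * D) := by
    have h1 := Real.one_sub_inv_le_log_of_pos (x := D / L) (by positivity)
    rw [Real.log_div hD0.ne' (by linarith), inv_div, ← hldef] at h1
    have h2 : 1 - L / D = (l - 1) / D := by
      rw [eq_div_iff hD0.ne', sub_mul, div_mul_cancel₀ _ hD0.ne']
      linarith
    rw [Real.log_mul hx0.ne' hD0.ne', ← hLdef]
    linarith
  have hpos : 0 ≤ (l - 1) / D := div_nonneg (by linarith) hD0.le
  have hlt : C / D < (l - 1) / D := by gcongr; linarith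
  rw [hg, liApprox]
  set T := Real.log (x * D) with hT
  have hDT : D ≤ T := by linarith
  have hT0 : 0 < T := by linarith
  have h3 : D * (1 + 1 / T + C / T ^ 2) < T := by
    have e1 : D / T ≤ 1 := by rw [div_le_one hT0]; exact hDT
    have e2 : C * D / T ^ 2 ≤ C / D := by
      rw [div_le_div_iff₀ (by positivity) hD0]
      nlinarith [mul_le_mul hDT hDT hD0.le hT0.le]
    calc D * (1 + 1 / T + C / T ^ 2) = D + D / T + C * D / T ^ 2 := by ring
      _ < T := by linarith
  calc x * D / T + x * D / T ^ 2 + C * (x * D / T ^ 3)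
      = x * (D * (1 + 1 / T + C / T ^ 2) / T) := by field_simp
    _ < x * 1 := by
        gcongr
        rw [div_lt_one hT0]
        exact h3
    _ = x := mul_one x

lemma eventually_g_lt_nthPrime : ∀ᶠ n : ℕ in atTop, g n < nthPrime n := by
  obtain ⟨C, hC4, hC⟩ := exists_primeCounting'_add_one_le_liApprox
  have hll : Tendsto (fun n : ℕ => Real.log (Real.log n)) atTop atTop :=
    Real.tendsto_log_atTop.comp (Real.tendsto_log_atTop.comp tendsto_natCast_atTop_atTop)
  filter_upwards [tendsto_nthPrime.eventually hC, hll.eventually_gt_atTop (C + 1),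
    eventually_ge_atTop 729] with n h1 h2 hn
  by_contra! h
  have hn' : (729 : ℝ) ≤ n := by exact_mod_cast hn
  have hp : (729 : ℝ) ≤ nthPrime n := by exact_mod_cast hn.trans (le_nthPrime n)
  have h3 : (n : ℝ) ≤ liApprox C (nthPrime n) := by
    have h4 : ((Nat.primeCounting' (nthPrime n) + 1 : ℕ) : ℝ) = n := by
      rw [primeCounting'_nthPrime_add_one (by omega)]
    rw [← h4]
    push_cast
    exact h1
  have h5 := liApprox_le_liApprox hC4 hp h
  have h6 := liApprox_g_lt (by linarith) hn' h2
  linarith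

/-- For all sufficiently large `n`, the `n`-th prime-indexed prime satisfies
`p_{p_n} > g(g(n))`. -/
theorem pip_lower_bound :
    ∀ᶠ n : ℕ in atTop, (nthPrime (nthPrime n) : ℝ) > g (g n) := by
  filter_upwards [eventually_g_lt_nthPrime, tendsto_nthPrime.eventually eventually_g_lt_nthPrime,
    eventually_ge_atTop 729] with n h1 h2 hn
  have hn' : (729 : ℝ) ≤ n := by exact_mod_cast hn
  exact (g_lt_g (hn'.trans (le_g hn')) h1).trans h2
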